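/- Let n ≥ 2. There exist constants a₋, a₊, k, r₀ > 0 depending only on n (in particular independent of u) such that the following holds: if u : 𝔹 → ℝ is pluriharmonic with |u(0)| > 0, and S = {w ∈ int(𝒜) : |u(w)| > |u(0)|/2} where 𝒜 = {w ∈ ℂⁿ : 1/8 ≤ ‖w‖ ≤ 1/4}, then there is a finite Borel measure μ on ℂⁿ supported in S with a₋ ≤ μ(ℂⁿ) ≤ a₊ which satisfies the wedge condition with constants k, r₀. -/

import Mathlib

open MeasureTheory Metric Complex Set

noncomputable section

/-- ℂⁿ, identified with ℝ^{2n} as a Euclidean space. -/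
abbrev Cn (n : ℕ) := EuclideanSpace ℂ (Fin n)

instance (n : ℕ) : MeasurableSpace (Cn n) := borel _
instance (n : ℕ) : BorelSpace (Cn n) := ⟨rfl⟩

/-- The truncated wedge W(s,α,γ) ⊆ ℂ. -/
def wedge (s α γ : ℝ) : Set ℂ :=
  {z | ∃ ρ φ : ℝ, 0 ≤ ρ ∧ |ρ - s| ≤ γ ∧ |φ - α| ≤ γ ∧ z = ρ * Complex.exp (Complex.I * φ)}

/-- The poly-wedge ∏_{j=1}^n W(s_j, α_j, γ) ⊆ ℂⁿ. -/
def polyWedge (n : ℕ) (s α : Fin n → ℝ) (γ : ℝ) : Set (Cn n) :=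
  {z | ∀ j, z j ∈ wedge (s j) (α j) γ}

/-- The wedge condition for a measure μ on ℂⁿ with constants k, r₀. -/
def WedgeCondition (n : ℕ) (μ : Measure (Cn n)) (k r₀ : ℝ) : Prop :=
  ∀ (s α : Fin n → ℝ), (∀ j, 0 ≤ s j) → (∀ j, α j ∈ Set.Ico 0 (2 * Real.pi)) →
    ∀ γ : ℝ, 0 < γ → γ < r₀ →
      μ (polyWedge n s α γ) ≤ ENNReal.ofReal (k * γ ^ (2 * n - 1))

/-- The constant c_{2n} = Γ(n-1)/(2π)ⁿ. -/
def newtonC (n : ℕ) : ℝ := Real.Gamma ((n : ℝ) - 1) / (2 * Real.pi) ^ n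

/-- The Newtonian potential of μ on ℂⁿ ≅ ℝ^{2n}. -/
def newtonPot (n : ℕ) (μ : Measure (Cn n)) (w : Cn n) : ℝ :=
  ∫ ζ, newtonC n * ‖w - ζ‖ ^ ((2 : ℝ) - 2 * n) ∂μ

/-- The Newtonian potential of μ, as a `ℝ≥0∞`-valued integral. -/
def newtonPotL (n : ℕ) (μ : Measure (Cn n)) (w : Cn n) : ENNReal :=
  ∫⁻ ζ, ENNReal.ofReal (newtonC n * ‖w - ζ‖ ^ ((2 : ℝ) - 2 * n)) ∂μ

/-- The point (s₁ e^{iα₁}, …, sₙ e^{iαₙ}) ∈ ℂⁿ. -/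
def mkPt (n : ℕ) (s α : Fin n → ℝ) : Cn n :=
  (WithLp.equiv 2 (Fin n → ℂ)).symm (fun j => (s j : ℂ) * Complex.exp (Complex.I * α j))

/-- The map Φ(θ, r, w₂, …, wₙ) = (r/√(1+Σ|w_j|²))·(e^{iθ}, e^{iθ}w̄₂, …, e^{iθ}w̄ₙ). -/
def Phi (n : ℕ) (θ r : ℝ) (w : Fin (n - 1) → ℂ) : Cn n :=
  (WithLp.equiv 2 (Fin n → ℂ)).symm (fun i =>
    ((r / Real.sqrt (1 + ∑ j, ‖w j‖ ^ 2) : ℝ) : ℂ) * Complex.exp (Complex.I * θ) *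
      (if h : (i : ℕ) = 0 then 1
       else (starRingEnd ℂ) (w ⟨(i : ℕ) - 1, by have := i.isLt; omega⟩)))

/-- The Stoltz domain C_{θ,r}: convex hull of {θ} ∪ closedBall 0 r. -/
def stoltz (n : ℕ) (θ : Cn n) (r : ℝ) : Set (Cn n) :=
  convexHull ℝ ({θ} ∪ closedBall 0 r)

/-- The Poisson kernel h_θ(w) = (1-‖w‖²)/‖θ-w‖^{2n} for the unit ball of ℂⁿ. -/
def poisson (n : ℕ) (θ w : Cn n) : ℝ :=
  (1 - ‖w‖ ^ 2) / ‖θ - w‖ ^ (2 * n)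

/-- u : 𝔹 → ℝ is pluriharmonic if it is the real part of a holomorphic function on 𝔹. -/
def Pluriharmonic (n : ℕ) (u : Cn n → ℝ) : Prop :=
  ∃ f : Cn n → ℂ, DifferentiableOn ℂ f (ball 0 1) ∧ ∀ z ∈ ball (0 : Cn n) 1, u z = (f z).re

end

noncomputable section

/-- Maximum principle: on the circle of radius one in a complex line through the origin,
the real part of a holomorphic function is somewhere larger than half its central value. -/
theorem exists_angle_half_lt_abs_re {g : ℂ → ℂ} {R : ℝ} (hR : 1 < R)
    (hg : DifferentiableOn ℂ g (ball 0 R)) (h0 : 0 < |(g 0).re|) :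
    ∃ t : ℝ, |(g 0).re| / 2 < |(g (Complex.exp (t * Complex.I))).re| := by
  by_contra! hcon
  obtain ⟨σ, hσ, hσ0⟩ : ∃ σ : ℝ, |σ| = 1 ∧ σ * (g 0).re = |(g 0).re| := by
    rcases le_total 0 (g 0).re with h | h
    · exact ⟨1, by simp, by rw [abs_of_nonneg h, one_mul]⟩
    · exact ⟨-1, by simp, by rw [abs_of_nonpos h, neg_one_mul]⟩
  have hsub : closedBall (0 : ℂ) 1 ⊆ ball 0 R := closedBall_subset_ball hR
  have hd : DiffContOnCl ℂ (fun z => Complex.exp (σ * g z)) (ball 0 1) := by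
    apply DifferentiableOn.diffContOnCl
    rw [closure_ball _ one_ne_zero]
    exact ((hg.mono hsub).const_mul _).cexp
  have hbound : ‖Complex.exp (σ * g 0)‖ ≤ Real.exp (|(g 0).re| / 2) := by
    refine Complex.norm_le_of_forall_mem_frontier_norm_le isBounded_ball hd (fun z hz => ?_)
      (subset_closure (mem_ball_self one_pos))
    rw [frontier_ball _ one_ne_zero, mem_sphere_zero_iff_norm] at hz
    have hz' : Complex.exp (z.arg * Complex.I) = z := by
      simpa [hz] using Complex.norm_mul_exp_arg_mul_I z
    have := hcon z.arg
    rw [hz'] at this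
    rw [Complex.norm_exp, Complex.re_ofReal_mul]
    refine Real.exp_le_exp.2 ((le_abs_self _).trans ?_)
    rwa [abs_mul, hσ, one_mul]
  rw [Complex.norm_exp, Complex.re_ofReal_mul, hσ0, Real.exp_le_exp] at hbound
  linarith

theorem isClosed_wedge (s α γ : ℝ) : IsClosed (wedge s α γ) := by
  have : wedge s α γ = (fun p : ℝ × ℝ => (p.1 : ℂ) * Complex.exp (Complex.I * p.2)) ''
      (Icc (max 0 (s - γ)) (s + γ) ×ˢ Icc (α - γ) (α + γ)) := by
    ext z
    simp only [wedge, mem_ofPred_eq, mem_image, mem_prod, mem_Icc, Prod.exists, abs_le, max_le_iff]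
    constructor
    · rintro ⟨ρ, φ, h0, h1, h2, rfl⟩
      exact ⟨ρ, φ, ⟨⟨⟨h0, by linarith⟩, by linarith⟩, by linarith, by linarith⟩, rfl⟩
    · rintro ⟨ρ, φ, ⟨⟨⟨h0, h1⟩, h2⟩, h3, h4⟩, rfl⟩
      exact ⟨ρ, φ, h0, ⟨by linarith, by linarith⟩, ⟨by linarith, by linarith⟩, rfl⟩
  rw [this]
  exact ((isCompact_Icc.prod isCompact_Icc).image (by fun_prop)).isClosed

theorem isClosed_polyWedge (n : ℕ) (s α : Fin n → ℝ) (γ : ℝ) : IsClosed (polyWedge n s α γ) := by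
  simp only [polyWedge, ofPred_forall]
  exact isClosed_iInter fun j => (isClosed_wedge _ _ _).preimage (by fun_prop)

/-- A point of a wedge, written in polar coordinates. -/
theorem polar_of_mem_wedge {s α γ ρ θ : ℝ} (hρ : 0 < ρ)
    (h : (ρ : ℂ) * Complex.exp (θ * Complex.I) ∈ wedge s α γ) :
    |ρ - s| ≤ γ ∧ ∃ m : ℤ, |θ - α - m * (2 * Real.pi)| ≤ γ := by
  obtain ⟨ρ', φ, h0, h1, h2, h3⟩ := h
  rw [mul_comm Complex.I] at h3
  have hn := congrArg norm h3
  simp only [norm_mul, Complex.norm_exp_ofReal_mul_I, mul_one, Complex.norm_real,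
    Real.norm_of_nonneg hρ.le, Real.norm_of_nonneg h0] at hn
  subst hn
  refine ⟨h1, ?_⟩
  obtain ⟨m, hm⟩ := Complex.exp_eq_exp_iff_exists_int.1
    (mul_left_cancel₀ (Complex.ofReal_ne_zero.2 hρ.ne') h3)
  refine ⟨m, ?_⟩
  have hm' := congrArg Complex.im hm
  simp at hm'
  rw [hm']
  convert h2 using 2
  ring

/-- Points of `[0, 1]` lying in a short arc modulo `2π` form a short set. -/
theorem volume_arc_le {c γ : ℝ} (hγ : γ < 1 / 4) :
    volume {b : ℝ | b ∈ Icc (0 : ℝ) 1 ∧ ∃ m : ℤ, |b - c - m * (2 * Real.pi)| ≤ 2 * γ} ≤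
      ENNReal.ofReal (4 * γ) := by
  refine (Real.volume_le_diam _).trans (Metric.ediam_le ?_)
  rintro x ⟨hx, m, hm⟩ y ⟨hy, l, hl⟩
  rw [edist_dist]
  apply ENNReal.ofReal_le_ofReal
  rw [Real.dist_eq]
  rw [abs_le] at hm hl ⊢
  have hpi := Real.pi_gt_three
  have hml : m = l := by
    have h1 : m < l + 1 := by
      by_contra! h
      have h' : (l : ℝ) + 1 ≤ m := by exact_mod_cast h
      nlinarith [hx.1, hx.2, hy.1, hy.2]
    have h2 : l < m + 1 := by
      by_contra! h
      have h' : (m : ℝ) + 1 ≤ l := by exact_mod_cast h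
      nlinarith [hx.1, hx.2, hy.1, hy.2]
    omega
  subst hml
  constructor <;> linarith

/-- The point with moduli `ρ` and arguments `0, β₁, …, βₘ`. -/
def polarPt (m : ℕ) (p : (Fin (m + 1) → ℝ) × (Fin m → ℝ)) : Cn (m + 1) :=
  WithLp.toLp 2 fun j =>
    (p.1 j : ℂ) * Complex.exp (((Fin.cons 0 p.2 : Fin (m + 1) → ℝ) j : ℝ) * Complex.I)

theorem continuous_polarPt (m : ℕ) : Continuous (polarPt m) := by
  refine (PiLp.continuous_toLp 2 _).comp (continuous_pi fun j => ?_)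
  refine Fin.cases ?_ (fun i => ?_) j
  · simp only [Fin.cons_zero]
    fun_prop
  · simp only [Fin.cons_succ]
    fun_prop

theorem norm_polarPt (m : ℕ) (p : (Fin (m + 1) → ℝ) × (Fin m → ℝ)) :
    ‖polarPt m p‖ ^ 2 = ∑ j, p.1 j ^ 2 := by
  simp [EuclideanSpace.norm_sq_eq, polarPt, Complex.norm_exp_ofReal_mul_I]

/-- The box of polar parameters. -/
def polarBox (m : ℕ) : Set ((Fin (m + 1) → ℝ) × (Fin m → ℝ)) :=
  (univ.pi fun _ => Ioo (1 / (8 * √((m : ℝ) + 1))) (1 / (4 * √((m : ℝ) + 1)))) ×ˢ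
    (univ.pi fun _ => Icc 0 1)

theorem measurableSet_polarBox (m : ℕ) : MeasurableSet (polarBox m) :=
  (MeasurableSet.univ_pi fun _ => measurableSet_Ioo).prod
    (MeasurableSet.univ_pi fun _ => measurableSet_Icc)

theorem volume_polarBox (m : ℕ) :
    volume (polarBox m) = ENNReal.ofReal ((1 / (8 * √((m : ℝ) + 1))) ^ (m + 1)) := by
  rw [polarBox, Measure.volume_eq_prod, Measure.prod_prod, volume_pi_pi, volume_pi_pi]
  simp only [Real.volume_Ioo, Real.volume_Icc, Finset.prod_const, Finset.card_univ,
    Fintype.card_fin, sub_zero, ENNReal.ofReal_one, one_pow, mul_one]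
  rw [ENNReal.ofReal_pow (by positivity)]
  congr 2
  field_simp
  norm_num

theorem norm_polarPt_mem {m : ℕ} {p : (Fin (m + 1) → ℝ) × (Fin m → ℝ)} (hp : p ∈ polarBox m) :
    1 / 8 < ‖polarPt m p‖ ∧ ‖polarPt m p‖ < 1 / 4 := by
  have hs : (0 : ℝ) < √((m : ℝ) + 1) := by positivity
  have hs2 : √((m : ℝ) + 1) ^ 2 = (m : ℝ) + 1 := Real.sq_sqrt (by positivity)
  have hmem : ∀ j, 1 / (8 * √((m : ℝ) + 1)) < p.1 j ∧ p.1 j < 1 / (4 * √((m : ℝ) + 1)) :=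
    fun j => hp.1 j (mem_univ j)
  have hpos : ∀ j, 0 ≤ p.1 j := fun j => (lt_trans (by positivity) (hmem j).1).le
  have hconst : ∀ c : ℝ, c ≠ 0 →
      ∑ _j : Fin (m + 1), (1 / (c * √((m : ℝ) + 1))) ^ 2 = (1 / c) ^ 2 := by
    intro c hc
    rw [Finset.sum_const, Finset.card_univ, Fintype.card_fin, nsmul_eq_mul, div_pow, mul_pow, hs2]
    push_cast
    field_simp
  constructor
  · refine lt_of_pow_lt_pow_left₀ 2 (norm_nonneg _) ?_
    rw [norm_polarPt, ← hconst 8 (by norm_num)]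
    exact Finset.sum_lt_sum_of_nonempty Finset.univ_nonempty
      fun j _ => pow_lt_pow_left₀ (hmem j).1 (by positivity) two_ne_zero
  · refine lt_of_pow_lt_pow_left₀ 2 (by norm_num) ?_
    rw [norm_polarPt, ← hconst 4 (by norm_num)]
    exact Finset.sum_lt_sum_of_nonempty Finset.univ_nonempty
      fun j _ => pow_lt_pow_left₀ (hmem j).2 (hpos j) two_ne_zero

/-- Rotating each point `polarPt m p` by an arbitrary angle `τ p` yields a measure satisfying
the wedge condition, since moduli and differences of arguments are unaffected. -/
theorem wedgeCondition_map_rotate {m : ℕ} {τ : (Fin (m + 1) → ℝ) × (Fin m → ℝ) → ℝ}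
    (hT : Measurable fun p => Complex.exp (τ p * Complex.I) • polarPt m p) :
    WedgeCondition (m + 1) ((volume.restrict (polarBox m)).map
      fun p => Complex.exp (τ p * Complex.I) • polarPt m p) (2 ^ (m + 1) * 4 ^ m) (1 / 4) := by
  intro s α _ _ γ hγ hγ'
  rw [Measure.map_apply hT (isClosed_polyWedge _ _ _ _).measurableSet,
    Measure.restrict_apply (hT (isClosed_polyWedge _ _ _ _).measurableSet)]
  have hsub : (fun p => Complex.exp (τ p * Complex.I) • polarPt m p) ⁻¹' polyWedge (m + 1) s α γ ∩
      polarBox m ⊆ (univ.pi fun j => Icc (s j - γ) (s j + γ)) ×ˢ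
        (univ.pi fun i : Fin m => {b : ℝ | b ∈ Icc (0 : ℝ) 1 ∧
          ∃ l : ℤ, |b - (α i.succ - α 0) - l * (2 * Real.pi)| ≤ 2 * γ}) := by
    rintro p ⟨hp, hbox⟩
    have hpol : ∀ j, |p.1 j - s j| ≤ γ ∧ ∃ l : ℤ,
        |τ p + (Fin.cons 0 p.2 : Fin (m + 1) → ℝ) j - α j - l * (2 * Real.pi)| ≤ γ := by
      intro j
      refine polar_of_mem_wedge (lt_trans (by positivity) (hbox.1 j (mem_univ j)).1) ?_
      convert hp j using 1
      simp only [polarPt, PiLp.smul_apply, smul_eq_mul]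
      rw [mul_left_comm, ← Complex.exp_add, Complex.ofReal_add, add_mul]
    refine ⟨fun j _ => ?_, fun i _ => ⟨hbox.2 i (mem_univ i), ?_⟩⟩
    · have := abs_le.1 (hpol j).1
      exact ⟨by linarith, by linarith⟩
    · obtain ⟨l, hl⟩ := (hpol i.succ).2
      obtain ⟨l₀, hl₀⟩ := (hpol 0).2
      refine ⟨l - l₀, ?_⟩
      rw [Fin.cons_succ] at hl
      rw [Fin.cons_zero] at hl₀
      rw [abs_le] at hl hl₀ ⊢
      push_cast
      constructor <;> linarith
  refine (measure_mono hsub).trans ?_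
  rw [Measure.volume_eq_prod, Measure.prod_prod, volume_pi_pi, volume_pi_pi]
  have h1 : ∏ j : Fin (m + 1), volume (Icc (s j - γ) (s j + γ)) =
      ENNReal.ofReal ((2 * γ) ^ (m + 1)) := by
    rw [ENNReal.ofReal_pow (by positivity)]
    simp only [Real.volume_Icc, add_sub_sub_cancel, ← two_mul, Finset.prod_const,
      Finset.card_univ, Fintype.card_fin]
  have h2 : ∏ i : Fin m, volume {b : ℝ | b ∈ Icc (0 : ℝ) 1 ∧
      ∃ l : ℤ, |b - (α i.succ - α 0) - l * (2 * Real.pi)| ≤ 2 * γ} ≤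
      ENNReal.ofReal ((4 * γ) ^ m) := by
    rw [ENNReal.ofReal_pow (by positivity)]
    refine (Finset.prod_le_prod' fun i _ => volume_arc_le hγ').trans ?_
    simp
  rw [h1]
  refine (mul_le_mul_right h2 _).trans ?_
  rw [← ENNReal.ofReal_mul (by positivity)]
  refine ENNReal.ofReal_le_ofReal (le_of_eq ?_)
  rw [show 2 * (m + 1) - 1 = m + 1 + m by omega, mul_pow, mul_pow, pow_add γ]
  ring

theorem Pluriharmonic.isOpen_annulus_half_lt {n : ℕ} {u : Cn n → ℝ} (hu : Pluriharmonic n u) :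
    IsOpen {w : Cn n | 1 / 8 < ‖w‖ ∧ ‖w‖ < 1 / 4 ∧ |u 0| / 2 < |u w|} := by
  obtain ⟨f, hf, huf⟩ := hu
  have hc : ContinuousOn (fun w => |u w|) (ball 0 1) :=
    (continuous_abs.comp Complex.continuous_re).comp_continuousOn hf.continuousOn |>.congr
      fun w hw => by simp [huf w hw]
  have h := ((isOpen_lt continuous_const continuous_norm).inter
    (isOpen_lt continuous_norm continuous_const)).inter
    (hc.isOpen_inter_preimage isOpen_ball (isOpen_Ioi (a := |u 0| / 2)))
    (s := {w : Cn n | (1 / 8 : ℝ) < ‖w‖} ∩ {w | ‖w‖ < 1 / 4})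
  refine (congrArg IsOpen (Set.ext fun w => ?_)).mpr h
  simp only [mem_ofPred_eq, mem_inter_iff, mem_ball_zero_iff, mem_preimage, mem_Ioi]
  constructor
  · rintro ⟨h1, h2, h3⟩
    exact ⟨⟨h1, h2⟩, by linarith, h3⟩
  · rintro ⟨⟨h1, h2⟩, _, h3⟩
    exact ⟨h1, h2, h3⟩

theorem Pluriharmonic.exists_rotate_half_lt {n : ℕ} {u : Cn n → ℝ} (hu : Pluriharmonic n u)
    (h0 : 0 < |u 0|) {v : Cn n} (hv : 1 / 8 < ‖v‖ ∧ ‖v‖ < 1 / 4) :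
    ∃ t : ℝ, Complex.exp (t * Complex.I) • v ∈
      {w : Cn n | 1 / 8 < ‖w‖ ∧ ‖w‖ < 1 / 4 ∧ |u 0| / 2 < |u w|} := by
  obtain ⟨f, hf, huf⟩ := hu
  have hmaps : MapsTo (fun z : ℂ => z • v) (ball 0 2) (ball 0 1) := by
    intro z hz
    rw [mem_ball_zero_iff] at hz ⊢
    rw [norm_smul]
    nlinarith [norm_nonneg v, norm_nonneg z]
  have hu0 : u 0 = (f ((0 : ℂ) • v)).re := by
    rw [zero_smul]
    exact huf 0 (mem_ball_self one_pos)
  obtain ⟨t, ht⟩ := exists_angle_half_lt_abs_re (g := fun z => f (z • v)) one_lt_two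
    (hf.comp (by fun_prop) hmaps) (by rwa [← hu0])
  have hnorm : ‖Complex.exp (t * Complex.I) • v‖ = ‖v‖ := by
    rw [norm_smul, Complex.norm_exp_ofReal_mul_I, one_mul]
  refine ⟨t, by rw [hnorm]; exact hv.1, by rw [hnorm]; exact hv.2, ?_⟩
  rw [huf (Complex.exp (t * Complex.I) • v) (hmaps ?_), hu0]
  · exact ht
  · rw [mem_ball_zero_iff, Complex.norm_exp_ofReal_mul_I]
    exact one_lt_two

/-- A measurable choice of rotation moving the polar box into an open set. -/
theorem exists_measurable_rotate {m : ℕ} {A : Set (Cn (m + 1))} (hA : IsOpen A)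
    (h : ∀ p ∈ polarBox m, ∃ t : ℝ, Complex.exp (t * Complex.I) • polarPt m p ∈ A) :
    ∃ τ : (Fin (m + 1) → ℝ) × (Fin m → ℝ) → ℝ, Measurable τ ∧
      ∀ p ∈ polarBox m, Complex.exp (τ p * Complex.I) • polarPt m p ∈ A := by
  classical
  let q := TopologicalSpace.denseSeq ℝ
  have hex : ∀ p, ∃ k, p ∉ polarBox m ∨ Complex.exp (q k * Complex.I) • polarPt m p ∈ A := by
    intro p
    by_cases hp : p ∈ polarBox m
    · obtain ⟨k, hk⟩ := (TopologicalSpace.denseRange_denseSeq ℝ).exists_mem_open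
        (hA.preimage (f := fun t : ℝ => Complex.exp (t * Complex.I) • polarPt m p) (by fun_prop))
        (h p hp)
      exact ⟨k, Or.inr hk⟩
    · exact ⟨0, Or.inl hp⟩
  refine ⟨fun p => q (Nat.find (hex p)), ?_, fun p hp => ?_⟩
  · refine measurable_from_nat.comp (measurable_find hex fun k => ?_)
    exact (measurableSet_polarBox m).compl.union (hA.preimage
      ((continuous_polarPt m).const_smul (Complex.exp (q k * Complex.I)))).measurableSet
  · exact (Nat.find_spec (hex p)).resolve_left (not_not.2 hp)

theorem stmt3 (n : ℕ) (hn : 2 ≤ n) :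
    ∃ aminus aplus k r₀ : ℝ, 0 < aminus ∧ 0 < aplus ∧ 0 < k ∧ 0 < r₀ ∧
      ∀ u : Cn n → ℝ, Pluriharmonic n u → 0 < |u 0| →
        ∃ μ : Measure (Cn n), IsFiniteMeasure μ ∧
          μ {w : Cn n | 1 / 8 < ‖w‖ ∧ ‖w‖ < 1 / 4 ∧ |u 0| / 2 < |u w|}ᶜ = 0 ∧
          ENNReal.ofReal aminus ≤ μ Set.univ ∧ μ Set.univ ≤ ENNReal.ofReal aplus ∧
          WedgeCondition n μ k r₀ := by
  obtain ⟨m, rfl⟩ : ∃ m, n = m + 1 := ⟨n - 1, by omega⟩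
  refine ⟨(1 / (8 * √((m : ℝ) + 1))) ^ (m + 1), (1 / (8 * √((m : ℝ) + 1))) ^ (m + 1),
    2 ^ (m + 1) * 4 ^ m, 1 / 4, by positivity, by positivity, by positivity, by norm_num, ?_⟩
  intro u hu h0
  have hA := hu.isOpen_annulus_half_lt
  obtain ⟨τ, hτ, hτA⟩ := exists_measurable_rotate hA
    fun p hp => hu.exists_rotate_half_lt h0 (norm_polarPt_mem hp)
  have hT : Measurable fun p => Complex.exp (τ p * Complex.I) • polarPt m p :=
    ((Complex.measurable_ofReal.comp hτ).mul_const _).cexp.smul (continuous_polarPt m).measurable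
  have hmass : ((volume.restrict (polarBox m)).map
      fun p => Complex.exp (τ p * Complex.I) • polarPt m p) univ =
      ENNReal.ofReal ((1 / (8 * √((m : ℝ) + 1))) ^ (m + 1)) := by
    rw [Measure.map_apply hT MeasurableSet.univ, preimage_univ, Measure.restrict_apply_univ,
      volume_polarBox]
  refine ⟨_, ⟨by rw [hmass]; exact ENNReal.ofReal_lt_top⟩, ?_, hmass.ge, hmass.le,
    wedgeCondition_map_rotate hT⟩
  rw [Measure.map_apply hT hA.measurableSet.compl,
    Measure.restrict_apply (hT hA.measurableSet.compl)]
  convert measure_empty (μ := volume)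
  exact eq_empty_of_forall_notMem fun p hp => hp.1 (hτA p hp.2)

end
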